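/- Let T be a Laver tree and f : [T] → 2^ℕ a Borel function. Then there exist a direct extension T' ≤₀ T and a function p from T' to finite binary sequences that is monotone (s ⊆ t implies p(s) ⊆ p(t)) and length-preserving (the length of p(t) equals the length of t), such that for every branch x ∈ [T'] and every n, the restriction of f(x) to {0,…,n−1} equals p(x restricted to n); in particular f is continuous (indeed 1-Lipschitz) on [T']. -/

import Mathlib

open Set Filter

/-- The restriction of `x : ℕ → ℕ` to `{0,…,n-1}`, as a finite sequence. -/
def seg (x : ℕ → ℕ) (n : ℕ) : List ℕ := List.ofFn fun i : Fin n => x i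

/-- `s` is the stem of the tree `T`: it belongs to `T`, is comparable with every
element of `T`, and every node of `T` extending it splits infinitely. -/
def IsStemOf (T : Set (List ℕ)) (s : List ℕ) : Prop :=
  s ∈ T ∧ (∀ t ∈ T, t <+: s ∨ s <+: t) ∧
    ∀ t ∈ T, s <+: t → {n : ℕ | t ++ [n] ∈ T}.Infinite

/-- A Laver tree: closed under initial segments, with a stem. -/
def IsLaverTree (T : Set (List ℕ)) : Prop :=
  (∀ s ∈ T, ∀ t : List ℕ, t <+: s → t ∈ T) ∧ ∃ s, IsStemOf T s

/-- `[T]`, the set of branches of `T`. -/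
def branches (T : Set (List ℕ)) : Set (ℕ → ℕ) := {x | ∀ n, seg x n ∈ T}

/-- `S ≤₀ T`: `S` is a Laver tree included in `T` with the same stem. -/
def DirectExt (S T : Set (List ℕ)) : Prop :=
  IsLaverTree S ∧ S ⊆ T ∧ ∃ s, IsStemOf S s ∧ IsStemOf T s

/-- An (proper, containing all finite sets) ideal on ℕ. -/
def IsIdeal (I : Set (Set ℕ)) : Prop :=
  (∀ A : Set ℕ, A.Finite → A ∈ I) ∧ (∀ A B : Set ℕ, A ⊆ B → B ∈ I → A ∈ I) ∧
    (∀ A B : Set ℕ, A ∈ I → B ∈ I → A ∪ B ∈ I) ∧ (Set.univ : Set ℕ) ∉ I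

/-- A P-ideal. -/
def IsPIdeal (I : Set (Set ℕ)) : Prop :=
  ∀ A : ℕ → Set ℕ, (∀ n, A n ∈ I) → ∃ B ∈ I, ∀ n, (A n \ B).Finite

/-- Characteristic function of a subset of ℕ, as a point of the Cantor space. -/
noncomputable def chi (A : Set ℕ) : ℕ → Bool :=
  fun n => @decide (n ∈ A) (Classical.propDecidable _)

/-- An F_σ set: a countable union of closed sets. -/
def IsFsigma {X : Type*} [TopologicalSpace X] (A : Set X) : Prop :=
  ∃ F : ℕ → Set X, (∀ n, IsClosed (F n)) ∧ A = ⋃ n, F n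

/-- An ideal on ℕ is F_σ if its copy in the Cantor space `ℕ → Bool` is F_σ. -/
def FsigmaIdeal (I : Set (Set ℕ)) : Prop := IsFsigma (chi '' I)

/-- The equivalence relation `E_I` on the Cantor space induced by an ideal `I`. -/
def EI (I : Set (Set ℕ)) (x y : ℕ → Bool) : Prop := {n | x n ≠ y n} ∈ I

/-- The generator `A_g` of the Laver ideal. -/
def laverGen (g : List ℕ → ℕ) : Set (ℕ → ℕ) := {f | {n | f n < g (seg f n)}.Infinite}

/-- Membership in the Laver ideal: covered by countably many generators. -/
def InLaverIdeal (A : Set (ℕ → ℕ)) : Prop :=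
  ∃ g : ℕ → List ℕ → ℕ, A ⊆ ⋃ i, laverGen (g i)

/-- The relation `K` on the Baire space. -/
def Krel (x y : ℕ → ℕ) : Prop :=
  ∃ b : ℕ, ∀ n : ℕ, ∃ mx ≤ b, ∃ my ≤ b, x n ≤ y (n + my) ∧ y n ≤ x (n + mx)

/-- `E_{ℓ∞}` on `ℝ^ℕ`: the difference sequence is bounded. -/
def Elinf (x y : ℕ → ℝ) : Prop := ∃ C : ℝ, ∀ n, |x n - y n| ≤ C

/-- A lower semicontinuous submeasure on ℕ. -/
def IsLSCSubmeasure (μ : Set ℕ → ENNReal) : Prop :=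
  μ ∅ = 0 ∧ (∀ A B : Set ℕ, A ⊆ B → μ A ≤ μ B) ∧
    (∀ A B : Set ℕ, μ (A ∪ B) ≤ μ A + μ B) ∧
    ∀ A : Set ℕ, μ A = ⨆ n : ℕ, μ (A ∩ Set.Iio n)

/-- `Exh(μ)`. -/
def Exh (μ : Set ℕ → ENNReal) : Set (Set ℕ) :=
  {A | Filter.Tendsto (fun n : ℕ => μ (A \ Set.Iio n)) Filter.atTop (nhds 0)}

/-- `Fin(μ)`. -/
def FinSub (μ : Set ℕ → ENNReal) : Set (Set ℕ) := {A | μ A < ⊤}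

/-! ### Initial segments and concatenation -/

/-- Concatenation of a finite sequence with an infinite one. -/
def app (s : List ℕ) (y : ℕ → ℕ) : ℕ → ℕ := fun i => s[i]?.getD (y (i - s.length))

@[simp] lemma app_nil (y : ℕ → ℕ) : app [] y = y := by
  funext i; simp [app]

lemma app_of_lt {s : List ℕ} {i : ℕ} (h : i < s.length) (y : ℕ → ℕ) : app s y i = s[i] := by
  simp [app, h]

lemma app_of_ge {s : List ℕ} {i : ℕ} (h : s.length ≤ i) (y : ℕ → ℕ) :
    app s y i = y (i - s.length) := by
  simp [app, h]

lemma app_append (s t : List ℕ) (y : ℕ → ℕ) : app (s ++ t) y = app s (app t y) := by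
  funext i
  simp only [app, List.getElem?_append, List.length_append]
  split_ifs with h
  · simp [h]
  · rw [List.getElem?_eq_none (not_lt.mp h), Option.getD_none, Nat.sub_sub]

@[simp] lemma length_seg (x : ℕ → ℕ) (n : ℕ) : (seg x n).length = n := by simp [seg]

@[simp] lemma seg_zero (x : ℕ → ℕ) : seg x 0 = [] := by simp [seg]

lemma seg_succ (x : ℕ → ℕ) (n : ℕ) : seg x (n + 1) = seg x n ++ [x n] := by
  exact (List.ofFn_succ' _).trans (by simp [seg])

lemma seg_prefix_seg (x : ℕ → ℕ) {m n : ℕ} (h : m ≤ n) : seg x m <+: seg x n := by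
  induction n, h using Nat.le_induction with
  | base => exact List.prefix_rfl
  | succ n _ ih => exact ih.trans (seg_succ x n ▸ List.prefix_append _ _)

lemma app_seg (x : ℕ → ℕ) (n : ℕ) : app (seg x n) (fun i => x (n + i)) = x := by
  funext i
  rcases lt_or_ge i n with h | h
  · rw [app_of_lt (by simpa using h)]; simp [seg]
  · rw [app_of_ge (by simpa using h)]; simp [h]

lemma seg_app_length (s : List ℕ) (y : ℕ → ℕ) : seg (app s y) s.length = s := by
  apply List.ext_getElem (by simp)
  intro i _ h
  simp [seg, app_of_lt h]

lemma seg_app_add (s : List ℕ) (y : ℕ → ℕ) (n : ℕ) :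
    seg (app s y) (s.length + n) = s ++ seg y n := by
  induction n with
  | zero => simp [seg_app_length]
  | succ n ih =>
    rw [← add_assoc, seg_succ, ih, seg_succ, app_of_ge (by omega)]
    simp

lemma seg_eq_of_prefix {x : ℕ → ℕ} {n : ℕ} {t : List ℕ} (h : t <+: seg x n) :
    seg x t.length = t := by
  have hn : t.length ≤ n := by simpa using h.length_le
  exact (List.prefix_of_prefix_length_le (seg_prefix_seg x hn) h (by simp)).eq_of_length (by simp)

/-! ### Everywhere infinitely splitting trees -/

/-- A tree all of whose nodes split infinitely, i.e. a Laver tree with empty stem. -/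
structure Splits (W : Set (List ℕ)) : Prop where
  nil_mem : [] ∈ W
  of_append : ∀ s t, s ++ t ∈ W → s ∈ W
  infinite : ∀ t ∈ W, {n : ℕ | t ++ [n] ∈ W}.Infinite

/-- The tree of the nodes of `W` above `t`, relative to `t`. -/
def above (W : Set (List ℕ)) (t : List ℕ) : Set (List ℕ) := {u | t ++ u ∈ W}

@[simp] lemma mem_above {W : Set (List ℕ)} {t u : List ℕ} : u ∈ above W t ↔ t ++ u ∈ W := Iff.rfl

@[simp] lemma above_nil (W : Set (List ℕ)) : above W [] = W := by ext; simp

lemma above_append (W : Set (List ℕ)) (s t : List ℕ) : above W (s ++ t) = above (above W s) t := by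
  ext; simp

lemma above_mono {V W : Set (List ℕ)} (h : V ⊆ W) (t : List ℕ) : above V t ⊆ above W t :=
  fun _ hu => h hu

lemma Splits.splits_above {W : Set (List ℕ)} (hW : Splits W) {t : List ℕ} (ht : t ∈ W) :
    Splits (above W t) where
  nil_mem := by simpa using ht
  of_append u v h := hW.of_append _ v (by simpa using h)
  infinite u hu := by simpa using hW.infinite _ hu

lemma branches_mono {V W : Set (List ℕ)} (h : V ⊆ W) : branches V ⊆ branches W :=
  fun _ hx n => h (hx n)

lemma shift_mem_branches_above {W : Set (List ℕ)} {y : ℕ → ℕ} (hy : y ∈ branches W) (n : ℕ) :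
    (fun i => y (n + i)) ∈ branches (above W (seg y n)) := by
  intro m
  have h := seg_app_add (seg y n) (fun i => y (n + i)) m
  rw [app_seg, length_seg] at h
  exact (h ▸ hy (n + m) : seg y n ++ _ ∈ W)

lemma Splits.branches_nonempty {W : Set (List ℕ)} (hW : Splits W) : (branches W).Nonempty := by
  choose! g hg using fun t (ht : t ∈ W) => (hW.infinite t ht).nonempty
  let node : ℕ → List ℕ := fun k => Nat.rec [] (fun _ t => t ++ [g t]) k
  have hnode : ∀ k, node k ∈ W := by
    intro k
    induction k with
    | zero => exact hW.nil_mem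
    | succ k ih => exact hg _ ih
  refine ⟨fun k => g (node k), fun k => ?_⟩
  suffices h : seg (fun k => g (node k)) k = node k from h ▸ hnode k
  induction k with
  | zero => simp [node]
  | succ k ih => rw [seg_succ, ih]

/-- The tree with set `I` of successors of the root and with `G n` above `[n]`. -/
def glue (I : Set ℕ) (G : ℕ → Set (List ℕ)) : Set (List ℕ)
  | [] => True
  | n :: u => n ∈ I ∧ u ∈ G n

lemma nil_mem_glue (I : Set ℕ) (G : ℕ → Set (List ℕ)) : [] ∈ glue I G := trivial

lemma splits_glue {I : Set ℕ} {G : ℕ → Set (List ℕ)} (hI : I.Infinite)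
    (hG : ∀ n ∈ I, Splits (G n)) : Splits (glue I G) where
  nil_mem := nil_mem_glue I G
  of_append s t h := by
    cases s with
    | nil => exact nil_mem_glue I G
    | cons n s => exact ⟨h.1, (hG n h.1).of_append s t h.2⟩
  infinite t ht := by
    cases t with
    | nil => exact hI.mono fun n hn => ⟨hn, (hG n hn).nil_mem⟩
    | cons n u => exact ((hG n ht.1).infinite u ht.2).mono fun m hm => ⟨ht.1, hm⟩

/-! ### Fusion -/

/-- The result of refining the tree `S`, placed above `t`, by `R` successively at every node. -/
def fuse (R : List ℕ → Set (List ℕ) → Set (List ℕ)) (t : List ℕ) (S : Set (List ℕ)) :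
    Set (List ℕ)
  | [] => True
  | n :: u => [n] ∈ R t S ∧ fuse R (t ++ [n]) (above (R t S) [n]) u

lemma nil_mem_fuse (R : List ℕ → Set (List ℕ) → Set (List ℕ)) (t : List ℕ)
    (S : Set (List ℕ)) : [] ∈ fuse R t S := trivial

/-- `R` maps splitting subtrees of `W` above its nodes to splitting subtrees of them. -/
def Refines (R : List ℕ → Set (List ℕ) → Set (List ℕ)) (W : Set (List ℕ)) : Prop :=
  ∀ t ∈ W, ∀ S, Splits S → S ⊆ above W t → R t S ⊆ S ∧ Splits (R t S)

lemma Refines.succ {R : List ℕ → Set (List ℕ) → Set (List ℕ)} {W : Set (List ℕ)}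
    (hR : Refines R W) {t : List ℕ} (ht : t ∈ W) {S : Set (List ℕ)} (hS : Splits S)
    (hSW : S ⊆ above W t) {n : ℕ} (hn : [n] ∈ R t S) :
    t ++ [n] ∈ W ∧ Splits (above (R t S) [n]) ∧ above (R t S) [n] ⊆ above W (t ++ [n]) := by
  obtain ⟨h₁, h₂⟩ := hR t ht S hS hSW
  refine ⟨hSW (h₁ hn), h₂.splits_above hn, ?_⟩
  rw [above_append]
  exact above_mono (h₁.trans hSW) [n]

lemma fuse_subset {R : List ℕ → Set (List ℕ) → Set (List ℕ)} {W : Set (List ℕ)}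
    (hR : Refines R W) {t : List ℕ} (ht : t ∈ W) {S : Set (List ℕ)} (hS : Splits S)
    (hSW : S ⊆ above W t) : fuse R t S ⊆ R t S := by
  intro u
  induction u generalizing t S with
  | nil => exact fun _ => (hR t ht S hS hSW).2.nil_mem
  | cons n u ih =>
    rintro ⟨hn, hu⟩
    obtain ⟨h₁, h₂, h₃⟩ := hR.succ ht hS hSW hn
    have h := ih h₁ h₂ h₃ hu
    exact (hR _ h₁ _ h₂ h₃).1 h

lemma splits_fuse {R : List ℕ → Set (List ℕ) → Set (List ℕ)} {W : Set (List ℕ)}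
    (hR : Refines R W) {t : List ℕ} (ht : t ∈ W) {S : Set (List ℕ)} (hS : Splits S)
    (hSW : S ⊆ above W t) : Splits (fuse R t S) where
  nil_mem := nil_mem_fuse R t S
  of_append u v h := by
    induction u generalizing t S with
    | nil => exact nil_mem_fuse R t S
    | cons n u ih =>
      obtain ⟨hn, hu⟩ := h
      obtain ⟨h₁, h₂, h₃⟩ := hR.succ ht hS hSW hn
      exact ⟨hn, ih h₁ h₂ h₃ hu⟩
  infinite u h := by
    induction u generalizing t S with
    | nil =>
      have h₂ := (hR t ht S hS hSW).2
      exact (h₂.infinite [] h₂.nil_mem).mono fun n hn => ⟨hn, nil_mem_fuse R (t ++ [n]) (above (R t S) [n])⟩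
    | cons n u ih =>
      obtain ⟨hn, hu⟩ := h
      obtain ⟨h₁, h₂, h₃⟩ := hR.succ ht hS hSW hn
      exact (ih h₁ h₂ h₃ hu).mono fun m hm => ⟨hn, hm⟩

lemma above_fuse {R : List ℕ → Set (List ℕ) → Set (List ℕ)} {W : Set (List ℕ)}
    (hR : Refines R W) {t : List ℕ} (ht : t ∈ W) {S : Set (List ℕ)} (hS : Splits S)
    (hSW : S ⊆ above W t) {u : List ℕ} (hu : u ∈ fuse R t S) :
    ∃ S', t ++ u ∈ W ∧ Splits S' ∧ S' ⊆ above W (t ++ u) ∧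
      above (fuse R t S) u ⊆ R (t ++ u) S' := by
  induction u generalizing t S with
  | nil => exact ⟨S, by simpa using ⟨ht, hS, hSW, fuse_subset hR ht hS hSW⟩⟩
  | cons n u ih =>
    obtain ⟨hn, hu⟩ := hu
    obtain ⟨h₁, h₂, h₃⟩ := hR.succ ht hS hSW hn
    obtain ⟨S', h₄, h₅, h₆, h₇⟩ := ih h₁ h₂ h₃ hu
    simp only [List.append_assoc, List.singleton_append] at h₄ h₆ h₇
    exact ⟨S', h₄, h₅, h₆, fun v hv => h₇ hv.2⟩

/-- Fusion: if a hereditary property `Q t` of trees above `t` can be obtained by shrinking, then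
it can be obtained simultaneously at all nodes of a subtree. -/
lemma Splits.exists_fusion {W : Set (List ℕ)} (hW : Splits W)
    {Q : List ℕ → Set (List ℕ) → Prop} (hQ : ∀ t S S', S' ⊆ S → Q t S → Q t S')
    (h : ∀ t ∈ W, ∀ S, Splits S → S ⊆ above W t → ∃ S' ⊆ S, Splits S' ∧ Q t S') :
    ∃ W' ⊆ W, Splits W' ∧ ∀ t ∈ W', Q t (above W' t) := by
  choose! R hR₁ hR₂ hR₃ using h
  have hR : Refines R W := fun t ht S hS hSW => ⟨hR₁ t ht S hS hSW, hR₂ t ht S hS hSW⟩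
  have hWW : W ⊆ above W [] := by simp
  refine ⟨fuse R [] W,
    (fuse_subset hR hW.nil_mem hW hWW).trans (hR _ hW.nil_mem W hW hWW).1,
    splits_fuse hR hW.nil_mem hW hWW, fun t ht => ?_⟩
  obtain ⟨S, h₁, h₂, h₃, h₄⟩ := above_fuse hR hW.nil_mem hW hWW ht
  exact hQ t _ _ h₄ (hR₃ t h₁ S h₂ h₃)

/-! ### Pure decision for Borel sets -/

/-- Some splitting subtree of `W` has all its branches, prolonged by `s`, in `A`. -/
def Forces (A : Set (ℕ → ℕ)) (s : List ℕ) (W : Set (List ℕ)) : Prop :=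
  ∃ W' ⊆ W, Splits W' ∧ ∀ y ∈ branches W', app s y ∈ A

lemma Forces.mono {A B : Set (ℕ → ℕ)} {s : List ℕ} {V W : Set (List ℕ)} (h : Forces A s V)
    (hAB : A ⊆ B) (hVW : V ⊆ W) : Forces B s W := by
  obtain ⟨W', h₁, h₂, h₃⟩ := h
  exact ⟨W', h₁.trans hVW, h₂, fun y hy => hAB (h₃ y hy)⟩

lemma forces_of_infinite {A : Set (ℕ → ℕ)} {s : List ℕ} {W : Set (List ℕ)} (hW : Splits W)
    (h : {n | [n] ∈ W ∧ Forces A (s ++ [n]) (above W [n])}.Infinite) : Forces A s W := by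
  choose! G hG₁ hG₂ hG₃ using
    fun n (hn : n ∈ {n | [n] ∈ W ∧ Forces A (s ++ [n]) (above W [n])}) => hn.2
  refine ⟨_, ?_, splits_glue h hG₂, fun y hy => ?_⟩
  · rintro (_ | ⟨n, u⟩) hu
    · exact hW.nil_mem
    · exact hG₁ n hu.1 hu.2
  · have hsucc := shift_mem_branches_above hy 1
    have h₁ : seg y 1 = [y 0] := by simp [seg_succ]
    have h₀ := (h₁ ▸ hy 1 : [y 0] ∈ glue _ G).1
    have := hG₃ (y 0) h₀ (fun i => y (1 + i)) fun k => (h₁ ▸ hsucc k : _ ∈ above _ [y 0]).2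
    rwa [app_append, ← h₁, app_seg] at this

/-- Above every finite sequence, every splitting tree can be shrunk into `A` or into `Aᶜ`. -/
def Decided (A : Set (ℕ → ℕ)) : Prop :=
  ∀ s W, Splits W → Forces A s W ∨ Forces Aᶜ s W

lemma Decided.compl {A : Set (ℕ → ℕ)} (h : Decided A) : Decided Aᶜ := fun s W hW => by
  rw [compl_compl]
  exact (h s W hW).symm

lemma decided_eval_preimage (i : ℕ) (U : Set ℕ) : Decided {x | x i ∈ U} := by
  suffices h : ∀ d s W, i + 1 ≤ s.length + d → Splits W →
      Forces {x | x i ∈ U} s W ∨ Forces {x | x i ∈ U}ᶜ s W from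
    fun s W hW => h (i + 1) s W (by omega) hW
  intro d
  induction d with
  | zero =>
    intro s W hi hW
    have hi : i < s.length := by omega
    by_cases h : s[i] ∈ U
    · exact Or.inl ⟨W, subset_rfl, hW, fun y _ => by simpa [app_of_lt hi] using h⟩
    · exact Or.inr ⟨W, subset_rfl, hW, fun y _ => by simpa [app_of_lt hi] using h⟩
  | succ d ih =>
    intro s W hi hW
    have hinf := hW.infinite [] hW.nil_mem
    by_contra! hno
    have h₁ := not_infinite.mp (mt (forces_of_infinite hW) hno.1)
    have h₂ := not_infinite.mp (mt (forces_of_infinite hW) hno.2)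
    refine hinf ((h₁.union h₂).subset fun n hn => ?_)
    have hn : [n] ∈ W := hn
    exact (ih (s ++ [n]) _ (by simp; omega) (hW.splits_above hn)).imp (⟨hn, ·⟩) (⟨hn, ·⟩)

lemma decided_iUnion {A : ℕ → Set (ℕ → ℕ)} (hA : ∀ i, Decided (A i)) : Decided (⋃ i, A i) := by
  intro s W hW
  refine or_iff_not_imp_left.mpr fun hbad => ?_
  let V : Set (List ℕ) :=
    {t | t ∈ W ∧ ∀ u, u <+: t → ¬ Forces (⋃ i, A i) (s ++ u) (above W u)}
  have hVW : V ⊆ W := fun t ht => ht.1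
  have hV : Splits V := by
    refine ⟨⟨hW.nil_mem, fun u hu => ?_⟩, fun t u h => ?_, fun t ht => ?_⟩
    · obtain rfl := List.prefix_nil.mp hu
      simpa using hbad
    · exact ⟨hW.of_append t u h.1, fun v hv => h.2 v (hv.trans (List.prefix_append t u))⟩
    · have hfin := not_infinite.mp
        (mt (forces_of_infinite (hW.splits_above ht.1)) (ht.2 t List.prefix_rfl))
      refine ((hW.infinite t ht.1).sdiff hfin).mono ?_
      rintro n ⟨hn, hn'⟩
      refine ⟨hn, fun u hu => ?_⟩
      rcases List.prefix_concat_iff.mp hu with rfl | hu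
      · intro hF
        refine hn' ⟨hn, ?_⟩
        rwa [← above_append, List.append_assoc]
      · exact ht.2 u hu
  obtain ⟨W', h₁, h₂, h₃⟩ := hV.exists_fusion
    (Q := fun t S => ∀ y ∈ branches S, app (s ++ t) y ∉ A t.length)
    (fun t S S' hS h y hy => h y (branches_mono hS hy)) fun t ht S hS hSV => by
      rcases hA t.length (s ++ t) S hS with hF | hF
      · exact absurd (hF.mono (subset_iUnion A _) (hSV.trans (above_mono hVW t)))
          (ht.2 t List.prefix_rfl)
      · exact hF
  refine ⟨W', h₁.trans hVW, h₂, fun y hy hyA => ?_⟩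
  obtain ⟨i, hi⟩ := mem_iUnion.mp hyA
  have := h₃ (seg y i) (hy i) _ (shift_mem_branches_above hy i)
  rw [app_append, app_seg, length_seg] at this
  exact this hi

lemma decided_of_measurableSet {A : Set (ℕ → ℕ)} (hA : MeasurableSet A) : Decided A := by
  let m : MeasurableSpace (ℕ → ℕ) :=
    { MeasurableSet' := Decided
      measurableSet_empty := fun s W hW => Or.inr ⟨W, subset_rfl, hW, by simp⟩
      measurableSet_compl := fun _ h => h.compl
      measurableSet_iUnion := fun _ h => decided_iUnion h }
  have hm : MeasurableSpace.pi ≤ m := by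
    refine iSup_le fun i => ?_
    rintro _ ⟨U, -, rfl⟩
    exact decided_eval_preimage i U
  exact hm A hA

/-- The first `k` bits of a Borel function can be decided on a subtree. -/
lemma exists_bits_const {f : (ℕ → ℕ) → (ℕ → Bool)} (hf : Measurable f) (s : List ℕ)
    {W : Set (List ℕ)} (hW : Splits W) (k : ℕ) :
    ∃ W' ⊆ W, Splits W' ∧ ∀ i < k, ∀ y ∈ branches W', ∀ z ∈ branches W',
      f (app s y) i = f (app s z) i := by
  induction k with
  | zero => exact ⟨W, subset_rfl, hW, by simp⟩
  | succ k ih =>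
    obtain ⟨V, hVW, hV, hconst⟩ := ih
    have hmeas : MeasurableSet {x | f x k = true} :=
      (measurable_pi_apply k |>.comp hf) (measurableSet_singleton true)
    have key : ∃ W' ⊆ V, Splits W' ∧ ∀ y ∈ branches W', ∀ z ∈ branches W',
        f (app s y) k = f (app s z) k := by
      rcases decided_of_measurableSet hmeas s V hV with ⟨W', h₁, h₂, h₃⟩ | ⟨W', h₁, h₂, h₃⟩
      · exact ⟨W', h₁, h₂, fun y hy z hz => (h₃ y hy).trans (h₃ z hz).symm⟩
      · refine ⟨W', h₁, h₂, fun y hy z hz => ?_⟩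
        rw [Bool.eq_false_of_not_eq_true (h₃ y hy), Bool.eq_false_of_not_eq_true (h₃ z hz)]
    obtain ⟨W', h₁, h₂, h₃⟩ := key
    refine ⟨W', h₁.trans hVW, h₂, fun i hi y hy z hz => ?_⟩
    rcases Nat.lt_succ_iff_lt_or_eq.mp hi with hi | rfl
    · exact hconst i hi y (branches_mono h₁ hy) z (branches_mono h₁ hz)
    · exact h₃ y hy z hz

/-! ### Trees with a given stem -/

/-- The tree with stem `s` and with `W` above `s`. -/
def stemTree (s : List ℕ) (W : Set (List ℕ)) : Set (List ℕ) := {t | t <+: s ∨ ∃ u ∈ W, t = s ++ u}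

lemma append_mem_stemTree {s : List ℕ} {W : Set (List ℕ)} (hW : Splits W) {u : List ℕ} :
    s ++ u ∈ stemTree s W ↔ u ∈ W := by
  refine ⟨?_, fun hu => Or.inr ⟨u, hu, rfl⟩⟩
  rintro (h | ⟨v, hv, h⟩)
  · have hu : u = [] := by
      have := h.length_le
      rw [List.length_append] at this
      exact List.eq_nil_of_length_eq_zero (by omega)
    exact hu ▸ hW.nil_mem
  · exact List.append_cancel_left h ▸ hv

lemma isStemOf_stemTree (s : List ℕ) {W : Set (List ℕ)} (hW : Splits W) :
    IsStemOf (stemTree s W) s := by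
  refine ⟨Or.inl List.prefix_rfl, ?_, ?_⟩
  · rintro t (ht | ⟨u, -, rfl⟩)
    · exact Or.inl ht
    · exact Or.inr (List.prefix_append s u)
  · rintro _ ht ⟨u, rfl⟩
    refine (hW.infinite u ((append_mem_stemTree hW).mp ht)).mono fun n hn => ?_
    rw [mem_ofPred_eq, List.append_assoc]
    exact (append_mem_stemTree hW).mpr hn

lemma isLaverTree_stemTree (s : List ℕ) {W : Set (List ℕ)} (hW : Splits W) :
    IsLaverTree (stemTree s W) := by
  refine ⟨?_, s, isStemOf_stemTree s hW⟩
  rintro t (ht | ⟨u, hu, rfl⟩) v hv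
  · exact Or.inl (hv.trans ht)
  · rcases List.prefix_or_prefix_of_prefix hv (List.prefix_append s u) with h | ⟨w, rfl⟩
    · exact Or.inl h
    · obtain ⟨w', rfl⟩ := (List.prefix_append_right_inj s).mp hv
      exact Or.inr ⟨w, hW.of_append w w' hu, rfl⟩

lemma app_mem_branches_stemTree {s : List ℕ} {W : Set (List ℕ)} {y : ℕ → ℕ}
    (hy : y ∈ branches W) : app s y ∈ branches (stemTree s W) := by
  intro n
  rcases le_total n s.length with h | h
  · left
    simpa [seg_app_length] using seg_prefix_seg (app s y) h
  · obtain ⟨m, rfl⟩ := Nat.exists_eq_add_of_le h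
    exact Or.inr ⟨seg y m, hy m, seg_app_add s y m⟩

lemma exists_app_eq_of_mem_branches_stemTree {s : List ℕ} {W : Set (List ℕ)} (hW : Splits W)
    {x : ℕ → ℕ} (hx : x ∈ branches (stemTree s W)) : ∃ y ∈ branches W, app s y = x := by
  have hs : seg x s.length = s := by
    rcases hx s.length with h | ⟨u, -, h⟩
    · exact h.eq_of_length (by simp)
    · exact seg_eq_of_prefix (h ▸ List.prefix_append s u)
  refine ⟨fun i => x (s.length + i), fun n => ?_, by conv_lhs => rw [← hs, length_seg, app_seg]⟩
  have h := shift_mem_branches_above hx s.length n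
  rw [hs] at h
  exact (append_mem_stemTree hW).mp h

lemma exists_branch_through {s : List ℕ} {W : Set (List ℕ)} (hW : Splits W) {t : List ℕ}
    (ht : t ∈ stemTree s W) : ∃ x ∈ branches (stemTree s W), seg x t.length = t := by
  obtain ⟨u, hu, htu⟩ : ∃ u ∈ W, t <+: s ++ u := by
    rcases ht with ht | ⟨u, hu, rfl⟩
    · exact ⟨[], hW.nil_mem, by simpa using ht⟩
    · exact ⟨u, hu, List.prefix_rfl⟩
  obtain ⟨z, hz⟩ := (hW.splits_above hu).branches_nonempty
  refine ⟨app s (app u z), app_mem_branches_stemTree fun n => ?_, ?_⟩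
  · obtain ⟨w, hw⟩ := seg_prefix_seg (app u z) (Nat.le_add_left n u.length)
    exact hW.of_append _ w (by rw [hw, seg_app_add]; exact hz n)
  · rw [← app_append]
    exact seg_eq_of_prefix (n := (s ++ u).length) (by rwa [seg_app_length])

/-- a Borel function on the branches of a Laver tree is Lipschitz
(given by a monotone length-preserving map on nodes) on a direct extension. -/
theorem stmt10 (T : Set (List ℕ)) (hT : IsLaverTree T)
    (f : (ℕ → ℕ) → (ℕ → Bool)) (hf : Measurable f) :
    ∃ T', DirectExt T' T ∧ ∃ p : List ℕ → List Bool,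
      (∀ s ∈ T', ∀ t ∈ T', s <+: t → p s <+: p t) ∧
      (∀ t ∈ T', (p t).length = t.length) ∧
      (∀ x ∈ branches T', ∀ n : ℕ,
        (List.ofFn fun i : Fin n => f x i) = p (seg x n)) ∧
      ContinuousOn f (branches T') := by
  obtain ⟨hclosed, s, hs⟩ := hT
  have hW₀ : Splits (above T s) := by
    refine ⟨by simpa using hs.1, fun t u h => hclosed _ h _ ?_, fun t ht => ?_⟩
    · rw [← List.append_assoc]
      exact List.prefix_append _ _
    · simpa using hs.2.2 _ ht (List.prefix_append s t)
  obtain ⟨W, hWT, hW, hconst⟩ := hW₀.exists_fusion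
    (Q := fun t S => ∀ i < (s ++ t).length, ∀ y ∈ branches S, ∀ z ∈ branches S,
      f (app (s ++ t) y) i = f (app (s ++ t) z) i)
    (fun t S S' hS h i hi y hy z hz => h i hi y (branches_mono hS hy) z (branches_mono hS hz))
    fun t _ S hS _ => exists_bits_const hf (s ++ t) hS _
  have key : ∀ x ∈ branches (stemTree s W), ∀ x' ∈ branches (stemTree s W), ∀ n,
      seg x n = seg x' n → ∀ i < n, f x i = f x' i := by
    intro x hx x' hx' n hn i hi
    obtain ⟨y, hy, rfl⟩ := exists_app_eq_of_mem_branches_stemTree hW hx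
    obtain ⟨z, hz, rfl⟩ := exists_app_eq_of_mem_branches_stemTree hW hx'
    have hm : seg y (n - s.length) = seg z (n - s.length) := by
      rcases le_total n s.length with h | h
      · simp [Nat.sub_eq_zero_of_le h]
      · obtain ⟨m, rfl⟩ := Nat.exists_eq_add_of_le h
        rw [seg_app_add, seg_app_add] at hn
        simpa using List.append_cancel_left hn
    have hz' := shift_mem_branches_above hz (n - s.length)
    rw [← hm] at hz'
    have := hconst _ (hy (n - s.length)) i (by simp; omega) _ (shift_mem_branches_above hy _) _ hz'
    rwa [app_append, app_append, app_seg, hm, app_seg] at this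
  choose! b hb hbt using fun t (ht : t ∈ stemTree s W) => exists_branch_through hW ht
  refine ⟨stemTree s W, ⟨isLaverTree_stemTree s hW, ?_, s, isStemOf_stemTree s hW, hs⟩,
    fun t => List.ofFn fun i : Fin t.length => f (b t) i, ?_, by simp, ?_, ?_⟩
  · rintro t (ht | ⟨u, hu, rfl⟩)
    · exact hclosed s hs.1 t ht
    · exact hWT hu
  · intro t ht u hu htu
    have hseg : seg (b u) t.length = t := seg_eq_of_prefix (n := u.length) (by rwa [hbt u hu])
    rw [List.prefix_iff_getElem]
    refine ⟨by simpa using htu.length_le, fun i hi => ?_⟩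
    simp only [List.length_ofFn] at hi
    simpa using key _ (hb t ht) _ (hb u hu) t.length ((hbt t ht).trans hseg.symm) i hi
  · intro x hx n
    have hbx := hbt _ (hx n)
    rw [length_seg] at hbx
    refine List.ext_getElem (by simp) fun i hi _ => ?_
    simp only [List.length_ofFn] at hi
    simpa using key x hx _ (hb _ (hx n)) n hbx.symm i hi
  · refine continuousOn_pi.mpr fun i x hx => ?_
    refine ContinuousWithinAt.congr_of_eventuallyEq
      (continuousWithinAt_const (b := f x i)) ?_ rfl
    have hopen : {x' : ℕ → ℕ | ∀ j ∈ Finset.range (i + 1), x' j = x j} ∈ nhds x := by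
      simp only [ofPred_forall]
      exact (biInter_finset_mem _).mpr fun j _ =>
        (continuous_apply j).continuousAt.preimage_mem_nhds
          (mem_nhds_discrete.mpr (mem_singleton (x j)))
    filter_upwards [mem_nhdsWithin_of_mem_nhds hopen, self_mem_nhdsWithin] with x' hx' hmem
    refine key x' hmem x hx (i + 1) ?_ i i.lt_succ_self
    exact List.ofFn_inj.mpr (funext fun j => hx' j (Finset.mem_range.mpr j.2))
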